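/- arXiv:1410.3195 — 2 statements merged into one kernel-verified Lean document; each statement's English description precedes it below -/
import Mathlib

section
/- For any nodal positions N₁,…,N₈ ∈ ℝ³, the Jacobian determinant J(ξ,η,ζ) of the trilinear isoparametric map X = Σᵢ φ^i Nᵢ is a polynomial lying in the span of the twenty monomials {1, ξ, η, ζ, ξη, ξζ, ηζ, ξ², η², ζ², ξηζ, ξ²η, ξη², ξ²ζ, η²ζ, ξζ², ηζ², ξ²ηζ, ξη²ζ, ξηζ²}; in particular J has degree at most 2 in each of ξ, η, ζ separately, has total degree at most 4, and contains no monomials of the forms ξ³, ξ²η², ξ²η²ζ, or ξ²η²ζ² (and their permutations). -/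
open scoped BigOperators

/-- ξ-coordinates of the eight vertices of the reference cube. -/
noncomputable def xv : Fin 8 → ℝ := ![-1, 1, 1, -1, -1, 1, 1, -1]
/-- η-coordinates of the eight vertices of the reference cube. -/
noncomputable def yv : Fin 8 → ℝ := ![-1, -1, 1, 1, -1, -1, 1, 1]
/-- ζ-coordinates of the eight vertices of the reference cube. -/
noncomputable def zv : Fin 8 → ℝ := ![-1, -1, -1, -1, 1, 1, 1, 1]

/-- Trilinear shape functions of the 8-node brick element. -/
noncomputable def φ (i : Fin 8) (ξ η ζ : ℝ) : ℝ :=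
  (1 + xv i * ξ) * (1 + yv i * η) * (1 + zv i * ζ) / 8

/-- Component `m` of the trilinear isoparametric map `X = Σᵢ φ^i Nᵢ`. -/
noncomputable def Xmap (N : Fin 8 → Fin 3 → ℝ) (m : Fin 3) (ξ η ζ : ℝ) : ℝ :=
  ∑ i : Fin 8, φ i ξ η ζ * N i m

/-- Jacobian matrix of the isoparametric map with respect to `(ξ, η, ζ)`. -/
noncomputable def Jmat (N : Fin 8 → Fin 3 → ℝ) (ξ η ζ : ℝ) :
    Matrix (Fin 3) (Fin 3) ℝ :=
  Matrix.of fun m n =>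
    if n = 0 then deriv (fun t => Xmap N m t η ζ) ξ
    else if n = 1 then deriv (fun t => Xmap N m ξ t ζ) η
    else deriv (fun t => Xmap N m ξ η t) ζ

/-- Jacobian determinant (metric) of the isoparametric map. -/
noncomputable def Jdet (N : Fin 8 → Fin 3 → ℝ) (ξ η ζ : ℝ) : ℝ :=
  (Jmat N ξ η ζ).det

/-- The determinant with columns `u v w`. -/
noncomputable def tdet (u v w : Fin 3 → ℝ) : ℝ :=
  u 0 * (v 1 * w 2 - v 2 * w 1) - v 0 * (u 1 * w 2 - u 2 * w 1)
    + w 0 * (u 1 * v 2 - u 2 * v 1)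

theorem Xmap_expand (N : Fin 8 → Fin 3 → ℝ) : ∃ a : Fin 8 → Fin 3 → ℝ, ∀ m ξ η ζ,
    Xmap N m ξ η ζ = a 0 m + a 1 m * ξ + a 2 m * η + a 3 m * ζ + a 4 m * (ξ * η)
      + a 5 m * (ξ * ζ) + a 6 m * (η * ζ) + a 7 m * (ξ * η * ζ) := by
  refine ⟨![fun m => (∑ i, N i m) / 8, fun m => (∑ i, xv i * N i m) / 8,
    fun m => (∑ i, yv i * N i m) / 8, fun m => (∑ i, zv i * N i m) / 8,
    fun m => (∑ i, xv i * yv i * N i m) / 8, fun m => (∑ i, xv i * zv i * N i m) / 8,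
    fun m => (∑ i, yv i * zv i * N i m) / 8,
    fun m => (∑ i, xv i * yv i * zv i * N i m) / 8], ?_⟩
  intro m ξ η ζ
  simp only [Xmap, φ, Matrix.cons_val, Finset.sum_div, Finset.sum_mul, ← Finset.sum_add_distrib]
  refine Finset.sum_congr rfl fun i _ => ?_
  ring

theorem deriv_affine (f : ℝ → ℝ) (p q x : ℝ) (h : ∀ t, f t = p + q * t) : deriv f x = q := by
  have : f = fun t => p + q * t := funext h
  rw [this]
  simpa using (((hasDerivAt_id x).const_mul q).const_add p).deriv

/-- For any nodal positions, the Jacobian determinant of the trilinear isoparametric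
map lies in the span of the twenty monomials
`{1, ξ, η, ζ, ξη, ξζ, ηζ, ξ², η², ζ², ξηζ, ξ²η, ξη², ξ²ζ, η²ζ, ξζ², ηζ², ξ²ηζ, ξη²ζ, ξηζ²}`. -/
theorem jacobian_determinant_monomial_span (N : Fin 8 → Fin 3 → ℝ) :
    ∃ c : Fin 20 → ℝ, ∀ ξ η ζ : ℝ,
      Jdet N ξ η ζ =
        c 0 + c 1 * ξ + c 2 * η + c 3 * ζ +
        c 4 * (ξ * η) + c 5 * (ξ * ζ) + c 6 * (η * ζ) +
        c 7 * ξ ^ 2 + c 8 * η ^ 2 + c 9 * ζ ^ 2 +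
        c 10 * (ξ * η * ζ) +
        c 11 * (ξ ^ 2 * η) + c 12 * (ξ * η ^ 2) +
        c 13 * (ξ ^ 2 * ζ) + c 14 * (η ^ 2 * ζ) +
        c 15 * (ξ * ζ ^ 2) + c 16 * (η * ζ ^ 2) +
        c 17 * (ξ ^ 2 * η * ζ) + c 18 * (ξ * η ^ 2 * ζ) +
        c 19 * (ξ * η * ζ ^ 2) := by
  obtain ⟨a, ha⟩ := Xmap_expand N
  refine ⟨![tdet (a 1) (a 2) (a 3),
    tdet (a 1) (a 2) (a 5) + tdet (a 1) (a 4) (a 3),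
    tdet (a 1) (a 2) (a 6) + tdet (a 4) (a 2) (a 3),
    tdet (a 1) (a 6) (a 3) + tdet (a 5) (a 2) (a 3),
    tdet (a 1) (a 2) (a 7) + tdet (a 1) (a 4) (a 6) + tdet (a 4) (a 2) (a 5),
    tdet (a 1) (a 6) (a 5) + tdet (a 1) (a 7) (a 3) + tdet (a 5) (a 4) (a 3),
    tdet (a 4) (a 6) (a 3) + tdet (a 5) (a 2) (a 6) + tdet (a 7) (a 2) (a 3),
    tdet (a 1) (a 4) (a 5),
    tdet (a 4) (a 2) (a 6),
    tdet (a 5) (a 6) (a 3),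
    tdet (a 1) (a 6) (a 7) + tdet (a 1) (a 7) (a 6) + tdet (a 4) (a 6) (a 5) + tdet (a 4) (a 7) (a 3) + tdet (a 5) (a 2) (a 7) + tdet (a 5) (a 4) (a 6) + tdet (a 7) (a 2) (a 5) + tdet (a 7) (a 4) (a 3),
    tdet (a 1) (a 4) (a 7),
    tdet (a 4) (a 2) (a 7),
    tdet (a 1) (a 7) (a 5),
    tdet (a 7) (a 2) (a 6),
    tdet (a 5) (a 7) (a 3),
    tdet (a 7) (a 6) (a 3),
    tdet (a 4) (a 7) (a 5) + tdet (a 5) (a 4) (a 7) + tdet (a 7) (a 4) (a 5),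
    tdet (a 4) (a 6) (a 7) + tdet (a 4) (a 7) (a 6) + tdet (a 7) (a 4) (a 6),
    tdet (a 5) (a 6) (a 7) + tdet (a 5) (a 7) (a 6) + tdet (a 7) (a 6) (a 5)], ?_⟩
  intro ξ η ζ
  have h0 : ∀ m, deriv (fun t => Xmap N m t η ζ) ξ
      = a 1 m + a 4 m * η + a 5 m * ζ + a 7 m * (η * ζ) := fun m =>
    deriv_affine _ (a 0 m + a 2 m * η + a 3 m * ζ + a 6 m * (η * ζ)) _ _
      fun t => by rw [ha]; ring
  have h1 : ∀ m, deriv (fun t => Xmap N m ξ t ζ) η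
      = a 2 m + a 4 m * ξ + a 6 m * ζ + a 7 m * (ξ * ζ) := fun m =>
    deriv_affine _ (a 0 m + a 1 m * ξ + a 3 m * ζ + a 5 m * (ξ * ζ)) _ _
      fun t => by rw [ha]; ring
  have h2 : ∀ m, deriv (fun t => Xmap N m ξ η t) ζ
      = a 3 m + a 5 m * ξ + a 6 m * η + a 7 m * (ξ * η) := fun m =>
    deriv_affine _ (a 0 m + a 1 m * ξ + a 2 m * η + a 4 m * (ξ * η)) _ _
      fun t => by rw [ha]; ring
  have hJ : Jdet N ξ η ζ = tdet (fun m => a 1 m + a 4 m * η + a 5 m * ζ + a 7 m * (η * ζ))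
      (fun m => a 2 m + a 4 m * ξ + a 6 m * ζ + a 7 m * (ξ * ζ))
      (fun m => a 3 m + a 5 m * ξ + a 6 m * η + a 7 m * (ξ * η)) := by
    simp only [Jdet, Matrix.det_fin_three, Jmat, Matrix.of_apply, h0, h1, h2, tdet]
    simp only [if_true, one_ne_zero, if_false, show (2 : Fin 3) ≠ 0 by decide,
      show (2 : Fin 3) ≠ 1 by decide]
    ring
  rw [hJ]
  simp only [Matrix.cons_val, tdet]
  ring
end

section
/- Exactness of the linear-metric (LM) lumped mass rule for affine Jacobian determinant: for any real numbers J₀, J̃₁, J̃₂, J̃₃ and nodal densities ρ₁,…,ρ₈, and every i ∈ {1,…,8}, ∫∫∫_{[-1,1]³} ρ₀ φ^i (J₀ + ξ J̃₁ + η J̃₂ + ζ J̃₃) dξ dη dζ = (1/27) [ J₀ Σⱼ₌₁⁸ 2^{3−d(i,j)} ρⱼ + J̃₁ ξᵢ Σ_{j : ξⱼ = ξᵢ} 2^{2−d(i,j)} ρⱼ + J̃₂ ηᵢ Σ_{j : ηⱼ = ηᵢ} 2^{2−d(i,j)} ρⱼ + J̃₃ ζᵢ Σ_{j : ζⱼ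 = ζᵢ} 2^{2−d(i,j)} ρⱼ ]; for instance, for i = 1 this reads 27 M^{11} = (8ρ₁+4ρ₂+2ρ₃+4ρ₄+4ρ₅+2ρ₆+ρ₇+2ρ₈)J₀ − (4ρ₁+2ρ₄+2ρ₅+ρ₈)J̃₁ − (4ρ₁+2ρ₂+2ρ₅+ρ₆)J̃₂ − (4ρ₁+2ρ₂+ρ₃+2ρ₄)J̃₃. -/
open scoped BigOperators

/-- Hamming distance between vertices `i` and `j`: the number of coordinates in which
the vertices `cᵢ` and `cⱼ` differ. -/
noncomputable def dH (i j : Fin 8) : ℕ :=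
  (if xv i = xv j then 0 else 1) + (if yv i = yv j then 0 else 1) +
    (if zv i = zv j then 0 else 1)

/-- Interpolated initial density `ρ₀ = Σⱼ ρⱼ φ^j`. -/
noncomputable def ρ₀ (ρ : Fin 8 → ℝ) (ξ η ζ : ℝ) : ℝ :=
  ∑ j : Fin 8, ρ j * φ j ξ η ζ

theorem cubic_int (a b c d : ℝ) :
    (∫ t in (-1 : ℝ)..1, (a + b * t + c * t ^ 2 + d * t ^ 3)) = 2 * a + 2 / 3 * c := by
  have : ∀ t ∈ Set.uIcc (-1 : ℝ) 1, HasDerivAt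
      (fun t : ℝ => a * t + b * (t ^ 2 / 2) + c * (t ^ 3 / 3) + d * (t ^ 4 / 4))
      (a + b * t + c * t ^ 2 + d * t ^ 3) t := by
    intro t _
    have h1 := (hasDerivAt_id t).const_mul a
    have h2 := ((hasDerivAt_pow 2 t).div_const 2).const_mul b
    have h3 := ((hasDerivAt_pow 3 t).div_const 3).const_mul c
    have h4 := ((hasDerivAt_pow 4 t).div_const 4).const_mul d
    refine (((h1.add h2).add h3).add h4).congr_deriv ?_
    push_cast
    ring
  rw [intervalIntegral.integral_eq_sub_of_hasDerivAt this
    (Continuous.intervalIntegrable (by fun_prop) _ _)]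
  ring

theorem lin_int (P Q D J R S y : ℝ) :
    (∫ t in (-1 : ℝ)..1, ((P + Q * t) * (D + J * t) + (R + S * t)) * (1 + y * t)) =
      (2 * P + 2 / 3 * (Q * y)) * D + (2 / 3 * (P * y + Q) * J + 2 * R + 2 / 3 * (S * y)) := by
  have h : (fun t : ℝ => ((P + Q * t) * (D + J * t) + (R + S * t)) * (1 + y * t)) =
      fun t => (P * D + R) + (P * J + Q * D + S + (P * D + R) * y) * t
        + (Q * J + (P * J + Q * D + S) * y) * t ^ 2 + (Q * J * y) * t ^ 3 := by
    funext t; ring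
  rw [h, cubic_int]; ring

theorem lin_int' (f : ℝ → ℝ) (P Q D J R S y : ℝ)
    (h : ∀ t, f t = ((P + Q * t) * (D + J * t) + (R + S * t)) * (1 + y * t)) :
    (∫ t in (-1 : ℝ)..1, f t) =
      (2 * P + 2 / 3 * (Q * y)) * D + (2 / 3 * (P * y + Q) * J + 2 * R + 2 / 3 * (S * y)) := by
  rw [← lin_int]; congr 1; funext t; exact h t

theorem tri_int (p0 p1 p2 p3 p12 p13 p23 p123 x y z J₀ J₁ J₂ J₃ : ℝ) :
    (∫ ξ in (-1 : ℝ)..1, ∫ η in (-1 : ℝ)..1, ∫ ζ in (-1 : ℝ)..1,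
      (p0 + p1 * ξ + p2 * η + p3 * ζ + p12 * (ξ * η) + p13 * (ξ * ζ) + p23 * (η * ζ)
        + p123 * (ξ * η * ζ)) * ((1 + x * ξ) * (1 + y * η) * (1 + z * ζ) / 8)
        * (J₀ + ξ * J₁ + η * J₂ + ζ * J₃)) =
      J₀ * (p0 + p1 * x / 3 + p2 * y / 3 + p3 * z / 3 + p12 * x * y / 9 + p13 * x * z / 9
        + p23 * y * z / 9 + p123 * x * y * z / 27)
      + J₁ / 3 * (p0 * x + p1 + (p2 * x + p12) * y / 3 + (p3 * x + p13) * z / 3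
        + (p23 * x + p123) * y * z / 9)
      + J₂ / 3 * (p0 * y + p2 + (p1 * y + p12) * x / 3 + (p3 * y + p23) * z / 3
        + (p13 * y + p123) * x * z / 9)
      + J₃ / 3 * (p0 * z + p3 + (p1 * z + p13) * x / 3 + (p2 * z + p23) * y / 3
        + (p12 * z + p123) * x * y / 9) := by
  have e1 : ∀ ξ η : ℝ, (∫ ζ in (-1 : ℝ)..1,
      (p0 + p1 * ξ + p2 * η + p3 * ζ + p12 * (ξ * η) + p13 * (ξ * ζ) + p23 * (η * ζ)
        + p123 * (ξ * η * ζ)) * ((1 + x * ξ) * (1 + y * η) * (1 + z * ζ) / 8)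
        * (J₀ + ξ * J₁ + η * J₂ + ζ * J₃)) = _ := fun ξ η =>
    lin_int' _ ((p0 + p1 * ξ + p2 * η + p12 * (ξ * η)) * ((1 + x * ξ) * (1 + y * η) / 8))
      ((p3 + p13 * ξ + p23 * η + p123 * (ξ * η)) * ((1 + x * ξ) * (1 + y * η) / 8))
      (J₀ + ξ * J₁ + η * J₂) J₃ 0 0 z (by intro t; ring)
  simp only [e1]
  have e2 : ∀ ξ : ℝ, (∫ η in (-1 : ℝ)..1,
      ((2 * ((p0 + p1 * ξ + p2 * η + p12 * (ξ * η)) * ((1 + x * ξ) * (1 + y * η) / 8)) +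
            2 / 3 * ((p3 + p13 * ξ + p23 * η + p123 * (ξ * η)) * ((1 + x * ξ) * (1 + y * η) / 8) * z)) *
          (J₀ + ξ * J₁ + η * J₂) +
        (2 / 3 *
                ((p0 + p1 * ξ + p2 * η + p12 * (ξ * η)) * ((1 + x * ξ) * (1 + y * η) / 8) * z +
                  (p3 + p13 * ξ + p23 * η + p123 * (ξ * η)) * ((1 + x * ξ) * (1 + y * η) / 8)) *
              J₃ +
            2 * 0 +
          2 / 3 * (0 * z)))) = _ := fun ξ =>
    lin_int' _
      ((2 * (p0 + p1 * ξ) + 2 / 3 * ((p3 + p13 * ξ) * z)) * ((1 + x * ξ) / 8))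
      ((2 * (p2 + p12 * ξ) + 2 / 3 * ((p23 + p123 * ξ) * z)) * ((1 + x * ξ) / 8))
      (J₀ + ξ * J₁) J₂
      (2 / 3 * ((p0 + p1 * ξ) * z + (p3 + p13 * ξ)) * J₃ * ((1 + x * ξ) / 8))
      (2 / 3 * ((p2 + p12 * ξ) * z + (p23 + p123 * ξ)) * J₃ * ((1 + x * ξ) / 8))
      y (by intro t; ring)
  simp only [e2]
  rw [lin_int' _
      ((2 * (2 * p0 + 2 / 3 * (p3 * z)) + 2 / 3 * ((2 * p2 + 2 / 3 * (p23 * z)) * y)) / 8)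
      ((2 * (2 * p1 + 2 / 3 * (p13 * z)) + 2 / 3 * ((2 * p12 + 2 / 3 * (p123 * z)) * y)) / 8)
      J₀ J₁
      ((2 / 3 * ((2 * p0 + 2 / 3 * (p3 * z)) * y + (2 * p2 + 2 / 3 * (p23 * z))) * J₂
        + 2 * (2 / 3 * (p0 * z + p3) * J₃) + 2 / 3 * (2 / 3 * (p2 * z + p23) * J₃ * y)) / 8)
      ((2 / 3 * ((2 * p1 + 2 / 3 * (p13 * z)) * y + (2 * p12 + 2 / 3 * (p123 * z))) * J₂
        + 2 * (2 / 3 * (p1 * z + p13) * J₃) + 2 / 3 * (2 / 3 * (p12 * z + p123) * J₃ * y)) / 8)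
      x (by intro t; ring)]
  ring

theorem rho_form (ρ : Fin 8 → ℝ) (ξ η ζ : ℝ) : ρ₀ ρ ξ η ζ =
    (ρ 0 + ρ 1 + ρ 2 + ρ 3 + ρ 4 + ρ 5 + ρ 6 + ρ 7) / 8
    + ((-ρ 0 + ρ 1 + ρ 2 - ρ 3 - ρ 4 + ρ 5 + ρ 6 - ρ 7) / 8) * ξ
    + ((-ρ 0 - ρ 1 + ρ 2 + ρ 3 - ρ 4 - ρ 5 + ρ 6 + ρ 7) / 8) * η
    + ((-ρ 0 - ρ 1 - ρ 2 - ρ 3 + ρ 4 + ρ 5 + ρ 6 + ρ 7) / 8) * ζ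
    + ((ρ 0 - ρ 1 + ρ 2 - ρ 3 + ρ 4 - ρ 5 + ρ 6 - ρ 7) / 8) * (ξ * η)
    + ((ρ 0 - ρ 1 - ρ 2 + ρ 3 - ρ 4 + ρ 5 + ρ 6 - ρ 7) / 8) * (ξ * ζ)
    + ((ρ 0 + ρ 1 - ρ 2 - ρ 3 - ρ 4 - ρ 5 + ρ 6 + ρ 7) / 8) * (η * ζ)
    + ((-ρ 0 + ρ 1 - ρ 2 + ρ 3 + ρ 4 - ρ 5 + ρ 6 - ρ 7) / 8) * (ξ * η * ζ) := by
  simp [ρ₀, φ, xv, yv, zv, Fin.sum_univ_eight]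
  ring

/-- Exactness of the linear-metric (LM) lumped mass rule for an affine Jacobian
determinant `J₀ + ξ J̃₁ + η J̃₂ + ζ J̃₃`, together with the explicit formula for the
first component `27 M^{11}`. -/
theorem lm_lumped_mass_exact (ρ : Fin 8 → ℝ) (J₀ J₁ J₂ J₃ : ℝ) :
    (∀ i : Fin 8,
      (∫ ξ in (-1 : ℝ)..1, ∫ η in (-1 : ℝ)..1, ∫ ζ in (-1 : ℝ)..1,
          ρ₀ ρ ξ η ζ * φ i ξ η ζ * (J₀ + ξ * J₁ + η * J₂ + ζ * J₃)) =
        (1 / 27) *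
          (J₀ * ∑ j : Fin 8, 2 ^ (3 - dH i j) * ρ j +
           J₁ * xv i * ∑ j : Fin 8, (if xv j = xv i then 2 ^ (2 - dH i j) * ρ j else 0) +
           J₂ * yv i * ∑ j : Fin 8, (if yv j = yv i then 2 ^ (2 - dH i j) * ρ j else 0) +
           J₃ * zv i * ∑ j : Fin 8, (if zv j = zv i then 2 ^ (2 - dH i j) * ρ j else 0))) ∧
    27 * (∫ ξ in (-1 : ℝ)..1, ∫ η in (-1 : ℝ)..1, ∫ ζ in (-1 : ℝ)..1,
        ρ₀ ρ ξ η ζ * φ 0 ξ η ζ * (J₀ + ξ * J₁ + η * J₂ + ζ * J₃)) =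
      (8 * ρ 0 + 4 * ρ 1 + 2 * ρ 2 + 4 * ρ 3 + 4 * ρ 4 + 2 * ρ 5 + ρ 6 + 2 * ρ 7) * J₀ -
      (4 * ρ 0 + 2 * ρ 3 + 2 * ρ 4 + ρ 7) * J₁ -
      (4 * ρ 0 + 2 * ρ 1 + 2 * ρ 4 + ρ 5) * J₂ -
      (4 * ρ 0 + 2 * ρ 1 + ρ 2 + 2 * ρ 3) * J₃ := by
  have ne1 : ¬ ((-1 : ℝ) = 1) := by norm_num
  have ne2 : ¬ ((1 : ℝ) = -1) := by norm_num
  simp only [rho_form]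
  simp only [φ, tri_int]
  constructor
  · intro i
    fin_cases i <;> simp [dH, xv, yv, zv, Fin.sum_univ_eight, ne1, ne2] <;> ring
  · simp [xv, yv, zv]
    ring
end
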